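/- arXiv:0801.2960 — 3 statements merged into one kernel-verified Lean document; each statement's English description precedes it below -/
import Mathlib

section
/- There is an absolute constant K_L > 1 such that for every v ∈ C_1 there exists a symplectic linear map L_v : ℝ⁴ → ℝ⁴ with the following properties: (1) L_v preserves the plane spanned by ∂/∂q₁ and ∂/∂q₂; (2) L_v(∂/∂p₁) is collinear to v; (3) for every w ∈ C_1, the vector L_v(w) has nonzero (p₁,p₂)-component and Θ(L_v(w)) = Θ(w) + Θ(v) in ℝ/πℤ; (4) ‖L_v‖ ≤ K_L and ‖L_v^{−1}‖ ≤ K_L. -/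
noncomputable section

/-- `ℝ⁴` with coordinates `(p₁, p₂, q₁, q₂)` at indices `0, 1, 2, 3`, with the
Euclidean norm. -/
abbrev E4 := EuclideanSpace ℝ (Fin 4)

/-- The standard symplectic form `ω = dp₁∧dq₁ + dp₂∧dq₂` on `ℝ⁴`. -/
def omega4 (v w : E4) : ℝ := v 0 * w 2 - v 2 * w 0 + (v 1 * w 3 - v 3 * w 1)

/-- The cone `C_β = {v : ‖(q₁,q₂)‖ < β ‖(p₁,p₂)‖}`. -/
def cone4 (β : ℝ) : Set E4 :=
  {v | Real.sqrt ((v 2) ^ 2 + (v 3) ^ 2) < β * Real.sqrt ((v 0) ^ 2 + (v 1) ^ 2)}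

/-- The angle `Θ(v) ∈ ℝ/πℤ` of the `(p₁,p₂)`-component of `v`: it satisfies
`(p₁,p₂) = ± r (cos Θ(v), sin Θ(v))` (for `(p₁,p₂) ≠ (0,0)`), since the complex
argument of `p₁ + i p₂`, taken mod `π`, is exactly such an angle. -/
def Theta4 (v : E4) : AddCircle Real.pi :=
  ((Complex.arg ⟨v 0, v 1⟩ : ℝ) : AddCircle Real.pi)

/-- The `q₁q₂`-plane, spanned by `∂/∂q₁` and `∂/∂q₂`. -/
def qPlane : Submodule ℝ E4 :=
  Submodule.span ℝ {(EuclideanSpace.single 2 1 : E4), (EuclideanSpace.single 3 1 : E4)}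

/-- The linear map `(p, q) ↦ (R p, R (q + M p))`, where `R` is the matrix `!![c, -s; s, c]`
and `M` is the symmetric matrix `!![α, β; β, 0]`. -/
def shearRotation (c s α β : ℝ) (h : c ^ 2 + s ^ 2 = 1) : E4 ≃ₗ[ℝ] E4 where
  toFun x := !₂[c * x 0 - s * x 1, s * x 0 + c * x 1,
    c * (x 2 + α * x 0 + β * x 1) - s * (x 3 + β * x 0),
    s * (x 2 + α * x 0 + β * x 1) + c * (x 3 + β * x 0)]
  invFun x := !₂[c * x 0 + s * x 1, -s * x 0 + c * x 1,
    c * x 2 + s * x 3 - α * (c * x 0 + s * x 1) - β * (-s * x 0 + c * x 1),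
    -s * x 2 + c * x 3 - β * (c * x 0 + s * x 1)]
  map_add' x y := by ext i; fin_cases i <;> simp <;> ring
  map_smul' a x := by ext i; fin_cases i <;> simp <;> ring
  left_inv x := by
    ext i; fin_cases i <;> simp
    · linear_combination x 0 * h
    · linear_combination x 1 * h
    · linear_combination (x 2) * h
    · linear_combination (x 3) * h
  right_inv x := by
    ext i; fin_cases i <;> simp
    · linear_combination x 0 * h
    · linear_combination x 1 * h
    · linear_combination (x 2) * h
    · linear_combination (x 3) * h

theorem omega4_shearRotation (c s α β : ℝ) (h : c ^ 2 + s ^ 2 = 1) (a b : E4) :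
    omega4 (shearRotation c s α β h a) (shearRotation c s α β h b) = omega4 a b := by
  simp [omega4, shearRotation]
  linear_combination (a 0 * b 2 - a 2 * b 0 + (a 1 * b 3 - a 3 * b 1)) * h

theorem mem_qPlane_iff (w : E4) : w ∈ qPlane ↔ w 0 = 0 ∧ w 1 = 0 := by
  rw [qPlane, Submodule.mem_span_pair]
  constructor
  · rintro ⟨a, b, rfl⟩
    simp
  · rintro ⟨h0, h1⟩
    refine ⟨w 2, w 3, ?_⟩
    ext i; fin_cases i <;> simp [h0, h1]

theorem E4.norm_le_three_mul_of_sq {x y : E4}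
    (h : y 0 ^ 2 + y 1 ^ 2 + y 2 ^ 2 + y 3 ^ 2 ≤
      9 * (x 0 ^ 2 + x 1 ^ 2 + x 2 ^ 2 + x 3 ^ 2)) : ‖y‖ ≤ 3 * ‖x‖ := by
  refine le_of_sq_le_sq ?_ (by positivity)
  rw [mul_pow, EuclideanSpace.real_norm_sq_eq, EuclideanSpace.real_norm_sq_eq,
    Fin.sum_univ_four, Fin.sum_univ_four]
  linarith

theorem sq_add_shear_le {α β : ℝ} (h : α ^ 2 + β ^ 2 ≤ 1) (p₁ p₂ q₁ q₂ : ℝ) :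
    p₁ ^ 2 + p₂ ^ 2 + (q₁ + α * p₁ + β * p₂) ^ 2 + (q₂ + β * p₁) ^ 2 ≤
      9 * (p₁ ^ 2 + p₂ ^ 2 + q₁ ^ 2 + q₂ ^ 2) := by
  have h₁ : (α * p₁ + β * p₂) ^ 2 ≤ p₁ ^ 2 + p₂ ^ 2 := by
    nlinarith [sq_nonneg (α * p₂ - β * p₁), mul_nonneg (sub_nonneg.2 h)
      (add_nonneg (sq_nonneg p₁) (sq_nonneg p₂))]
  have h₂ : (β * p₁) ^ 2 ≤ p₁ ^ 2 := by
    nlinarith [sq_nonneg (α * p₁), mul_nonneg (sub_nonneg.2 h) (sq_nonneg p₁)]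
  nlinarith [sq_nonneg (q₁ - (α * p₁ + β * p₂)), sq_nonneg (q₂ - β * p₁),
    sq_nonneg p₁, sq_nonneg p₂, sq_nonneg q₁, sq_nonneg q₂]

theorem norm_shearRotation_le {c s α β : ℝ} (h : c ^ 2 + s ^ 2 = 1) (hαβ : α ^ 2 + β ^ 2 ≤ 1)
    (x : E4) : ‖shearRotation c s α β h x‖ ≤ 3 * ‖x‖ := by
  refine E4.norm_le_three_mul_of_sq (le_of_eq_of_le ?_
    (sq_add_shear_le hαβ (x 0) (x 1) (x 2) (x 3)))
  simp [shearRotation]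
  linear_combination (x 0 ^ 2 + x 1 ^ 2 + (x 2 + α * x 0 + β * x 1) ^ 2 +
    (x 3 + β * x 0) ^ 2) * h

theorem norm_shearRotation_symm_le {c s α β : ℝ} (h : c ^ 2 + s ^ 2 = 1)
    (hαβ : α ^ 2 + β ^ 2 ≤ 1) (x : E4) :
    ‖(shearRotation c s α β h).symm x‖ ≤ 3 * ‖x‖ := by
  apply E4.norm_le_three_mul_of_sq
  have key := sq_add_shear_le (α := -α) (β := -β) (by simpa using hαβ)
    (c * x 0 + s * x 1) (-s * x 0 + c * x 1) (c * x 2 + s * x 3) (-s * x 2 + c * x 3)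
  have e : (c * x 0 + s * x 1) ^ 2 + (-s * x 0 + c * x 1) ^ 2 + (c * x 2 + s * x 3) ^ 2 +
      (-s * x 2 + c * x 3) ^ 2 = x 0 ^ 2 + x 1 ^ 2 + x 2 ^ 2 + x 3 ^ 2 := by
    linear_combination (x 0 ^ 2 + x 1 ^ 2 + x 2 ^ 2 + x 3 ^ 2) * h
  rw [e] at key
  refine le_of_eq_of_le ?_ key
  simp [shearRotation]
  ring

theorem sq_add_sq_pos_of_mem_cone4 {v : E4} (hv : v ∈ cone4 1) : 0 < v 0 ^ 2 + v 1 ^ 2 := by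
  simp only [cone4, one_mul, Set.mem_ofPred_eq] at hv
  exact Real.sqrt_pos.1 ((Real.sqrt_nonneg _).trans_lt hv)

theorem sq_add_sq_lt_of_mem_cone4 {v : E4} (hv : v ∈ cone4 1) :
    v 2 ^ 2 + v 3 ^ 2 < v 0 ^ 2 + v 1 ^ 2 := by
  simp only [cone4, one_mul, Set.mem_ofPred_eq] at hv
  exact (Real.sqrt_lt_sqrt_iff (by positivity)).1 hv

/-- The complex argument of a product is the sum of the arguments modulo `π`. -/
theorem coe_arg_mul_addCircle_pi {z w : ℂ} (hz : z ≠ 0) (hw : w ≠ 0) :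
    ((z * w).arg : AddCircle Real.pi) = (z.arg : AddCircle Real.pi) + w.arg := by
  have h := Complex.arg_mul_coe_angle hz hw
  rw [← Real.Angle.coe_add, Real.Angle.angle_eq_iff_two_pi_dvd_sub] at h
  obtain ⟨k, hk⟩ := h
  rw [← AddCircle.coe_add, ← sub_eq_zero, ← AddCircle.coe_sub, AddCircle.coe_eq_zero_iff]
  refine ⟨2 * k, ?_⟩
  rw [hk, zsmul_eq_mul]
  push_cast
  ring

/-- There is an absolute constant `K_L > 1` such that for every
`v ∈ C₁` there is a symplectic linear map `L_v : ℝ⁴ → ℝ⁴` preserving the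
`q₁q₂`-plane, sending `∂/∂p₁` to a vector collinear with `v`, adding `Θ(v)` to the
`Θ`-angle of every vector of the cone `C₁`, and with `‖L_v‖, ‖L_v⁻¹‖ ≤ K_L`. -/
theorem stmt_2 :
    ∃ K_L : ℝ, 1 < K_L ∧
      ∀ v ∈ cone4 1, ∃ L : E4 ≃ₗ[ℝ] E4,
        (∀ a b : E4, omega4 (L a) (L b) = omega4 a b) ∧
        (∀ w ∈ qPlane, L w ∈ qPlane) ∧
        (∃ c : ℝ, L (EuclideanSpace.single 0 1) = c • v) ∧
        (∀ w ∈ cone4 1, ((L w) 0, (L w) 1) ≠ (0, 0) ∧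
          Theta4 (L w) = Theta4 w + Theta4 v) ∧
        (∀ x : E4, ‖L x‖ ≤ K_L * ‖x‖) ∧ (∀ x : E4, ‖L.symm x‖ ≤ K_L * ‖x‖) := by
  refine ⟨3, by norm_num, fun v hv => ?_⟩
  have hpos := sq_add_sq_pos_of_mem_cone4 hv
  have hlt := sq_add_sq_lt_of_mem_cone4 hv
  set r := Real.sqrt (v 0 ^ 2 + v 1 ^ 2) with hr
  have hr0 : 0 < r := Real.sqrt_pos.2 hpos
  have hr2 : r ^ 2 = v 0 ^ 2 + v 1 ^ 2 := Real.sq_sqrt hpos.le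
  obtain ⟨c, hc⟩ : ∃ c, c = v 0 / r := ⟨_, rfl⟩
  obtain ⟨s, hs⟩ : ∃ s, s = v 1 / r := ⟨_, rfl⟩
  obtain ⟨a, ha⟩ : ∃ a, a = v 2 / r := ⟨_, rfl⟩
  obtain ⟨b, hb⟩ : ∃ b, b = v 3 / r := ⟨_, rfl⟩
  have h : c ^ 2 + s ^ 2 = 1 := by
    rw [hc, hs]; field_simp; exact hr2.symm
  have hab : a ^ 2 + b ^ 2 ≤ 1 := by
    rw [ha, hb, div_pow, div_pow, ← add_div, div_le_one (by positivity)]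
    linarith
  have hαβ : (c * a + s * b) ^ 2 + (-s * a + c * b) ^ 2 ≤ 1 := by
    refine le_of_eq_of_le ?_ hab
    linear_combination (a ^ 2 + b ^ 2) * h
  refine ⟨shearRotation c s (c * a + s * b) (-s * a + c * b) h,
    omega4_shearRotation _ _ _ _ h, ?_, ⟨r⁻¹, ?_⟩, ?_,
    norm_shearRotation_le h hαβ, norm_shearRotation_symm_le h hαβ⟩
  · intro w hw
    rw [mem_qPlane_iff] at hw ⊢
    simp [shearRotation, hw.1, hw.2]
  · ext i
    fin_cases i <;> simp [shearRotation]
    · rw [hc]; ring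
    · rw [hs]; ring
    · have : a = r⁻¹ * v 2 := by rw [ha]; ring
      linear_combination a * h + this
    · have : b = r⁻¹ * v 3 := by rw [hb]; ring
      linear_combination b * h + this
  · intro w hw
    have hwpos := sq_add_sq_pos_of_mem_cone4 hw
    refine ⟨fun h0 => ?_, ?_⟩
    · simp [shearRotation] at h0
      have : w 0 ^ 2 + w 1 ^ 2 = 0 := by
        linear_combination (c * w 0 - s * w 1) * h0.1 + (s * w 0 + c * w 1) * h0.2 -
          (w 0 ^ 2 + w 1 ^ 2) * h
      exact hwpos.ne' this
    · have ne_zero {x y : ℝ} (hxy : 0 < x ^ 2 + y ^ 2) : (⟨x, y⟩ : ℂ) ≠ 0 := by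
        intro h0
        simp [Complex.ext_iff] at h0
        simp [h0.1, h0.2] at hxy
      have harg : Complex.arg ⟨v 0, v 1⟩ = Complex.arg ⟨c, s⟩ := by
        rw [← Complex.arg_real_mul ⟨c, s⟩ hr0]
        congr 1
        apply Complex.ext <;> simp [hc, hs] <;> field_simp
      rw [Theta4, Theta4, Theta4, harg,
        ← coe_arg_mul_addCircle_pi (ne_zero hwpos) (ne_zero (by rw [h]; exact one_pos))]
      congr 2
      apply Complex.ext <;> simp [shearRotation] <;> ring
end
end

section
/- Let ν ∈ {1,…,N−1}, δ > 0, κ > 0 be given, together with: symplectic linear maps A_0, …, A_{m−1} : ℝ^{2N} → ℝ^{2N} preserving ℝ^{2ν}, so that one may write A_i(x,y) = (B_i(x), C_i(y)) for x ∈ ℝ^{2ν}, y ∈ (ℝ^{2ν})^ω; and for each i = 0,…,m−1 a smooth function H_i : ℝ^{2ν} → ℝ such that ‖D²H_i‖ < δ uniformly and H_i is constant outside B_{i−1}∘⋯∘B_0(U), where U is the open unit ball in ℝ^{2ν}. Then there exist: a number a > 0 defining the cylinder Û = {(x,y) ∈ ℝ^{2N} : ‖x‖ < 1, ‖y‖ <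 a}; smooth functions Ĥ_i : ℝ^{2N} → ℝ such that ‖D²Ĥ_i‖ < 2δ uniformly and Ĥ_i is constant outside A_{i−1}∘⋯∘A_0(Û); and a measurable set Ĝ ⊂ Û with μ(Ĝ) > (1−κ) μ(Û) such that for every (x,y) ∈ Ĝ and every t ∈ ℝ, A_{m−1} ∘ φ_{Ĥ_{m−1}}^t ∘ ⋯ ∘ A_0 ∘ φ_{Ĥ_0}^t (x,y) = (B_{m−1} ∘ φ_{H_{m−1}}^t ∘ ⋯ ∘ B_0 ∘ φ_{H_0}^t (x), C_{m−1}∘⋯∘C_0(y)). -/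
noncomputable section

open MeasureTheory

/-- The standard symplectic form `ω = Σᵢ dpᵢ ∧ dqᵢ` on `ℝ^{2n}`, where the
coordinates `p₁,…,p_n` occupy the first `n` indices and `q₁,…,q_n` the last `n`. -/
def stdSymp (n : ℕ) (v w : EuclideanSpace ℝ (Fin (n + n))) : ℝ :=
  ∑ i : Fin n,
    (v (Fin.castAdd n i) * w (Fin.natAdd n i) - v (Fin.natAdd n i) * w (Fin.castAdd n i))

/-- `chain g n = g (n-1) ∘ ⋯ ∘ g 0` (the identity for `n = 0`). -/
def chain {α : Type*} (g : ℕ → α → α) : ℕ → α → α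
  | 0 => id
  | n + 1 => g n ∘ chain g n

lemma stdSymp_single_natAdd (n : ℕ) (v : EuclideanSpace ℝ (Fin (n + n))) (i : Fin n) :
    stdSymp n v (EuclideanSpace.single (Fin.natAdd n i) 1) = v (Fin.castAdd n i) := by
  have h : ∀ j : Fin n, Fin.castAdd n j ≠ Fin.natAdd n i := fun j h => by
    have := congrArg Fin.val h
    simp at this
    omega
  simp [stdSymp, h, -Fin.natAdd_eq_addNat]

lemma stdSymp_single_castAdd (n : ℕ) (v : EuclideanSpace ℝ (Fin (n + n))) (i : Fin n) :
    stdSymp n v (EuclideanSpace.single (Fin.castAdd n i) 1) = -v (Fin.natAdd n i) := by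
  have h : ∀ j : Fin n, Fin.natAdd n j ≠ Fin.castAdd n i := fun j h => by
    have := congrArg Fin.val h
    simp at this
    omega
  simp [stdSymp, h, -Fin.natAdd_eq_addNat]

lemma stdSymp_nondegenerate (n : ℕ) (v : EuclideanSpace ℝ (Fin (n + n)))
    (h : ∀ w, stdSymp n v w = 0) : v = 0 := by
  ext k
  refine Fin.addCases (fun i => ?_) (fun i => ?_) k
  · simpa using (stdSymp_single_natAdd n v i).symm.trans (h _)
  · simpa using (stdSymp_single_castAdd n v i).symm.trans (h _)

/-- The direct sum of two standard symplectic forms, as a map to the dual space. -/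
def prodSympDual (m n : ℕ) :
    (EuclideanSpace ℝ (Fin (m + m)) × EuclideanSpace ℝ (Fin (n + n))) →ₗ[ℝ]
      Module.Dual ℝ (EuclideanSpace ℝ (Fin (m + m)) × EuclideanSpace ℝ (Fin (n + n))) :=
  LinearMap.mk₂ ℝ (fun p q => stdSymp m p.1 q.1 + stdSymp n p.2 q.2)
    (fun p p' q => by
      simp only [stdSymp, Prod.fst_add, Prod.snd_add, PiLp.add_apply, Finset.sum_add_distrib,
        add_mul, Finset.sum_sub_distrib]; ring)
    (fun c p q => by
      simp only [stdSymp, Prod.smul_fst, Prod.smul_snd, PiLp.smul_apply, smul_eq_mul, mul_add,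
        Finset.mul_sum, mul_sub, mul_assoc])
    (fun p q q' => by
      simp only [stdSymp, Prod.fst_add, Prod.snd_add, PiLp.add_apply, Finset.sum_add_distrib,
        mul_add, Finset.sum_sub_distrib]; ring)
    (fun c p q => by
      simp only [stdSymp, Prod.smul_fst, Prod.smul_snd, PiLp.smul_apply, smul_eq_mul, mul_add,
        Finset.mul_sum, mul_sub, mul_left_comm])

lemma stdSymp_zero_right (n : ℕ) (v : EuclideanSpace ℝ (Fin (n + n))) : stdSymp n v 0 = 0 := by
  simp [stdSymp]

lemma stdSymp_zero_left (n : ℕ) (v : EuclideanSpace ℝ (Fin (n + n))) : stdSymp n 0 v = 0 := by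
  simp [stdSymp]

lemma prodSympDual_injective (m n : ℕ) : Function.Injective (prodSympDual m n) := by
  rw [injective_iff_map_eq_zero]
  intro p hp
  have h : ∀ q : EuclideanSpace ℝ (Fin (m + m)) × EuclideanSpace ℝ (Fin (n + n)),
      stdSymp m p.1 q.1 + stdSymp n p.2 q.2 = 0 :=
    fun q => LinearMap.congr_fun hp q
  refine Prod.ext (stdSymp_nondegenerate m _ fun w => ?_) (stdSymp_nondegenerate n _ fun w => ?_)
  · simpa [stdSymp_zero_right] using h (w, 0)
  · simpa [stdSymp_zero_right] using h (0, w)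

/-- A vector field dual to a Lipschitz one-form is Lipschitz. -/
lemma exists_lipschitzWith_of_prodSymp_eq {m n : ℕ}
    {X : EuclideanSpace ℝ (Fin (m + m)) × EuclideanSpace ℝ (Fin (n + n)) →
      EuclideanSpace ℝ (Fin (m + m)) × EuclideanSpace ℝ (Fin (n + n))}
    {α : EuclideanSpace ℝ (Fin (m + m)) × EuclideanSpace ℝ (Fin (n + n)) →
      (EuclideanSpace ℝ (Fin (m + m)) × EuclideanSpace ℝ (Fin (n + n))) →L[ℝ] ℝ}
    {K : NNReal} (hα : LipschitzWith K α)
    (hX : ∀ p q, stdSymp m (X p).1 q.1 + stdSymp n (X p).2 q.2 = α p q) :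
    ∃ L, LipschitzWith L X := by
  let T := LinearMap.toContinuousLinearMap.toLinearMap ∘ₗ prodSympDual m n
  have hT : Function.Injective T :=
    LinearMap.toContinuousLinearMap.injective.comp (prodSympDual_injective m n)
  obtain ⟨c, -, hc⟩ := T.exists_antilipschitzWith (LinearMap.ker_eq_bot.2 hT)
  have hTX : ∀ p, T (X p) = α p := fun p => ContinuousLinearMap.ext fun q => hX p q
  refine ⟨c * K, LipschitzWith.of_dist_le_mul fun p q => ?_⟩
  calc dist (X p) (X q) ≤ c * dist (T (X p)) (T (X q)) := hc.le_mul_dist _ _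
    _ = c * dist (α p) (α q) := by rw [hTX, hTX]
    _ ≤ c * (K * dist p q) := by gcongr; exact hα.dist_le_mul _ _
    _ = _ := by push_cast; ring

section Hessian

variable {E F : Type*} [NormedAddCommGroup E] [NormedSpace ℝ E]
  [NormedAddCommGroup F] [NormedSpace ℝ F]

lemma fderiv_fderiv_comp_clm_apply {f : F → ℝ} (hf : ContDiff ℝ 2 f) (S : E →L[ℝ] F) (p v w : E) :
    fderiv ℝ (fderiv ℝ fun p => f (S p)) p v w = fderiv ℝ (fderiv ℝ f) (S p) (S v) (S w) := by
  have h1 : Differentiable ℝ f := hf.differentiable (by norm_num)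
  have h2 : Differentiable ℝ (fderiv ℝ f) :=
    (hf.fderiv_right (m := 1) (by norm_num)).differentiable (by norm_num)
  have e : (fderiv ℝ fun p => f (S p)) = fun p => (fderiv ℝ f (S p)).comp S := by
    funext p
    exact ((h1 (S p)).hasFDerivAt.comp p S.hasFDerivAt).fderiv
  have h3 : HasFDerivAt (fun p => fderiv ℝ f (S p)) ((fderiv ℝ (fderiv ℝ f) (S p)).comp S) p :=
    (h2 (S p)).hasFDerivAt.comp p S.hasFDerivAt
  rw [e, (h3.clm_comp (hasFDerivAt_const S p)).fderiv]
  simp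

lemma fderiv_mul_prod_apply {h : E → ℝ} {g : F → ℝ} (hh : Differentiable ℝ h)
    (hg : Differentiable ℝ g) (p w : E × F) :
    fderiv ℝ (fun p : E × F => h p.1 * g p.2) p w
      = h p.1 * fderiv ℝ g p.2 w.2 + g p.2 * fderiv ℝ h p.1 w.1 := by
  have h1 : HasFDerivAt (fun p : E × F => h p.1) ((fderiv ℝ h p.1).comp (.fst ℝ E F)) p :=
    (hh p.1).hasFDerivAt.comp p hasFDerivAt_fst
  have h2 : HasFDerivAt (fun p : E × F => g p.2) ((fderiv ℝ g p.2).comp (.snd ℝ E F)) p :=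
    (hg p.2).hasFDerivAt.comp p hasFDerivAt_snd
  rw [(show HasFDerivAt (fun p : E × F => h p.1 * g p.2) _ p from h1.mul h2).fderiv]
  simp

lemma fderiv_fderiv_mul_prod_apply_inl {h : E → ℝ} {g : F → ℝ} (hh : ContDiff ℝ 2 h)
    (hg : ContDiff ℝ 2 g) (p : E × F) (v w : E) :
    fderiv ℝ (fderiv ℝ fun p : E × F => h p.1 * g p.2) p (v, 0) (w, 0)
      = g p.2 * fderiv ℝ (fderiv ℝ h) p.1 v w := by
  have hh1 : Differentiable ℝ h := hh.differentiable (by norm_num)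
  have hg1 : Differentiable ℝ g := hg.differentiable (by norm_num)
  have hh2 : Differentiable ℝ (fderiv ℝ h) :=
    (hh.fderiv_right (m := 1) (by norm_num)).differentiable (by norm_num)
  have hf : ContDiff ℝ 2 fun p : E × F => h p.1 * g p.2 :=
    (hh.comp contDiff_fst).mul (hg.comp contDiff_snd)
  have hf2 : Differentiable ℝ (fderiv ℝ fun p : E × F => h p.1 * g p.2) :=
    (hf.fderiv_right (m := 1) (by norm_num)).differentiable (by norm_num)
  have e1 : fderiv ℝ (fderiv ℝ fun p : E × F => h p.1 * g p.2) p (v, 0) (w, 0)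
      = fderiv ℝ (fun q => fderiv ℝ (fun p : E × F => h p.1 * g p.2) q (w, 0)) p (v, 0) := by
    rw [((hf2 p).hasFDerivAt.clm_apply (hasFDerivAt_const ((w, 0) : E × F) p)).fderiv]
    simp
  have e2 : (fun q => fderiv ℝ (fun p : E × F => h p.1 * g p.2) q (w, 0))
      = fun q : E × F => fderiv ℝ h q.1 w * g q.2 := by
    funext q
    rw [fderiv_mul_prod_apply hh1 hg1]
    simp [mul_comm]
  have hw : HasFDerivAt (fun x => fderiv ℝ h x w) ((fderiv ℝ (fderiv ℝ h) p.1).flip w) p.1 := by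
    refine ((hh2 p.1).hasFDerivAt.clm_apply (hasFDerivAt_const w p.1)).congr_fderiv ?_
    simp
  rw [e1, e2, fderiv_mul_prod_apply (h := fun x => fderiv ℝ h x w)
    (fun x => (hh2 x).clm_apply (differentiableAt_const w)) hg1, hw.fderiv]
  simp

lemma abs_bilin_scaled_le {D : E × F →L[ℝ] E × F →L[ℝ] ℝ} {s c M : ℝ} (hs : 0 ≤ s) (hc : 0 ≤ c)
    (hM : ‖D‖ ≤ M) (hD : ∀ v w : E, |D (v, 0) (w, 0)| ≤ c * ‖v‖ * ‖w‖) (v w : E × F) :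
    |D (v.1, s • v.2) (w.1, s • w.2)| ≤ (c + M * (2 * s + s * s)) * ‖v‖ * ‖w‖ := by
  have hM0 : 0 ≤ M := (ContinuousLinearMap.opNorm_nonneg _).trans hM
  have split : D (v.1, s • v.2) (w.1, s • w.2) = D (v.1, 0) (w.1, 0) + s * D (v.1, 0) (0, w.2)
      + s * D (0, v.2) (w.1, 0) + s * s * D (0, v.2) (0, w.2) := by
    have hv : ∀ v : E × F, ((v.1, s • v.2) : E × F) = (v.1, 0) + s • (0, v.2) :=
      fun v => by simp
    rw [hv v, hv w]
    simp only [map_add, map_smul, add_apply, smul_apply, smul_eq_mul]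
    ring
  have hDle : ∀ u u' : E × F, ‖u‖ ≤ ‖v‖ → ‖u'‖ ≤ ‖w‖ → |D u u'| ≤ M * (‖v‖ * ‖w‖) := by
    intro u u' hu hu'
    calc |D u u'| ≤ ‖D‖ * ‖u‖ * ‖u'‖ := D.le_opNorm₂ u u'
      _ ≤ M * ‖v‖ * ‖w‖ := by gcongr
      _ = _ := by ring
  have inl_le : ∀ v : E × F, ‖((v.1, 0) : E × F)‖ ≤ ‖v‖ := fun v => by
    simp [Prod.norm_def]
  have inr_le : ∀ v : E × F, ‖((0, v.2) : E × F)‖ ≤ ‖v‖ := fun v => by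
    simp [Prod.norm_def]
  have b1 := hDle _ _ (inl_le v) (inr_le w)
  have b2 := hDle _ _ (inr_le v) (inl_le w)
  have b3 := hDle _ _ (inr_le v) (inr_le w)
  have b0 : |D (v.1, 0) (w.1, 0)| ≤ c * ‖v‖ * ‖w‖ := by
    refine (hD _ _).trans ?_
    gcongr
    exacts [norm_fst_le v, norm_fst_le w]
  rw [split]
  calc _ ≤ |D (v.1, 0) (w.1, 0)| + s * |D (v.1, 0) (0, w.2)| + s * |D (0, v.2) (w.1, 0)|
        + s * s * |D (0, v.2) (0, w.2)| := by
        refine (abs_add_le _ _).trans (add_le_add ((abs_add_le _ _).trans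
          (add_le_add ((abs_add_le _ _).trans (add_le_add le_rfl ?_)) ?_)) ?_) <;>
        simp [abs_mul, abs_of_nonneg hs]
    _ ≤ c * ‖v‖ * ‖w‖ + s * (M * (‖v‖ * ‖w‖))
        + s * (M * (‖v‖ * ‖w‖)) + s * s * (M * (‖v‖ * ‖w‖)) := by gcongr
    _ = _ := by ring

lemma exists_norm_fderiv_fderiv_le {f : E → ℝ} (hf : ContDiff ℝ 2 f) (hfs : HasCompactSupport f) :
    ∃ M, ∀ p, ‖fderiv ℝ (fderiv ℝ f) p‖ ≤ M :=
  ((hf.fderiv_right (m := 1) (by norm_num)).continuous_fderiv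
    (by norm_num)).bounded_above_of_compact_support ((hfs.fderiv ℝ).fderiv ℝ)

lemma norm_fderiv_fderiv_mul_scaled_le {h : E → ℝ} {g : F → ℝ}
    (hh : ContDiff ℝ 2 h) (hg : ContDiff ℝ 2 g) (hg1 : ∀ y, |g y| ≤ 1) {M s : ℝ}
    (hM : ∀ p : E × F, ‖fderiv ℝ (fderiv ℝ fun p : E × F => h p.1 * g p.2) p‖ ≤ M)
    (hs : 0 ≤ s) (p : E × F) :
    ‖fderiv ℝ (fderiv ℝ fun p : E × F => h p.1 * g (s • p.2)) p‖ ≤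
      ‖fderiv ℝ (fderiv ℝ h) p.1‖ + M * (2 * s + s * s) := by
  have hf : ContDiff ℝ 2 fun p : E × F => h p.1 * g p.2 :=
    (hh.comp contDiff_fst).mul (hg.comp contDiff_snd)
  have hM0 : 0 ≤ M := (ContinuousLinearMap.opNorm_nonneg _).trans (hM 0)
  have hc : 0 ≤ ‖fderiv ℝ (fderiv ℝ h) p.1‖ := ContinuousLinearMap.opNorm_nonneg _
  refine ContinuousLinearMap.opNorm_le_bound₂ _ (by positivity) fun v w => ?_
  have e : fderiv ℝ (fderiv ℝ fun p : E × F => h p.1 * g (s • p.2)) p v w =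
      fderiv ℝ (fderiv ℝ fun p : E × F => h p.1 * g p.2) (p.1, s • p.2)
        (v.1, s • v.2) (w.1, s • w.2) :=
    fderiv_fderiv_comp_clm_apply hf ((ContinuousLinearMap.id ℝ E).prodMap (s • .id ℝ F)) p v w
  rw [e]
  refine abs_bilin_scaled_le hs hc (hM (p.1, s • p.2)) (fun v w => ?_) v w
  rw [fderiv_fderiv_mul_prod_apply_inl hh hg, abs_mul]
  calc _ ≤ 1 * (‖fderiv ℝ (fderiv ℝ h) p.1‖ * ‖v‖ * ‖w‖) :=
        mul_le_mul (hg1 _) ((fderiv ℝ (fderiv ℝ h) p.1).le_opNorm₂ v w)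
          (abs_nonneg _) zero_le_one
    _ = _ := one_mul _

/-- Cutting off slowly in the second variable increases the Hessian by an arbitrarily small
amount. -/
lemma eventually_norm_fderiv_fderiv_mul_scaled_lt {h : E → ℝ} {g : F → ℝ}
    (hh : ContDiff ℝ 2 h) (hg : ContDiff ℝ 2 g)
    (hhs : HasCompactSupport h) (hgs : HasCompactSupport g) (hg1 : ∀ y, |g y| ≤ 1)
    {δ ε : ℝ} (hε : 0 < ε) (hδ : ∀ x, ‖fderiv ℝ (fderiv ℝ h) x‖ < δ) :
    ∀ᶠ a : ℝ in Filter.atTop, ∀ p : E × F,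
      ‖fderiv ℝ (fderiv ℝ fun p : E × F => h p.1 * g (a⁻¹ • p.2)) p‖ < δ + ε := by
  have hfs : HasCompactSupport fun p : E × F => h p.1 * g p.2 := by
    refine HasCompactSupport.intro (hhs.isCompact.prod hgs.isCompact) fun p hp => ?_
    by_contra hne
    exact hp ⟨subset_tsupport _ (left_ne_zero_of_mul hne),
      subset_tsupport _ (right_ne_zero_of_mul hne)⟩
  obtain ⟨M, hM⟩ := exists_norm_fderiv_fderiv_le
    ((hh.comp contDiff_fst).mul (hg.comp contDiff_snd)) hfs
  have hlim : Filter.Tendsto (fun a : ℝ => M * (2 * a⁻¹ + a⁻¹ * a⁻¹)) Filter.atTop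
      (nhds (M * (2 * 0 + 0 * 0))) :=
    ((tendsto_inv_atTop_zero.const_mul 2).add
      (tendsto_inv_atTop_zero.mul tendsto_inv_atTop_zero)).const_mul M
  have hlim' := hlim.eventually (gt_mem_nhds (b := M * (2 * 0 + 0 * 0)) (a := ε)
    (by simpa using hε))
  filter_upwards [hlim', Filter.eventually_gt_atTop 0] with a ha ha0 p
  exact (norm_fderiv_fderiv_mul_scaled_le hh hg hg1 hM (inv_pos.2 ha0).le p).trans_lt
    (add_lt_add (hδ p.1) ha)

end Hessian

/-- The composition of the first `n` linear equivalences of a sequence. -/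
def chainEquiv {E : Type*} [AddCommGroup E] [Module ℝ E] (B : ℕ → E ≃ₗ[ℝ] E) : ℕ → E ≃ₗ[ℝ] E
  | 0 => .refl ℝ E
  | n + 1 => (chainEquiv B n).trans (B n)

lemma chain_coe_eq_chainEquiv {E : Type*} [AddCommGroup E] [Module ℝ E] (B : ℕ → E ≃ₗ[ℝ] E)
    (n : ℕ) : chain (fun j => (B j : E → E)) n = chainEquiv B n := by
  induction n with
  | zero => rfl
  | succ n ih => funext x; simp [chain, ih, chainEquiv]

lemma chain_prod {α β : Type*} (f : ℕ → α → α) (g : ℕ → β → β) (n : ℕ) (q : α × β) :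
    chain (fun j (q : α × β) => (f j q.1, g j q.2)) n q = (chain f n q.1, chain g n q.2) := by
  induction n with
  | zero => rfl
  | succ n ih => simp [chain, ih]

lemma exists_pow_gt_of_lt_one (n : ℕ) {c : ℝ} (hc : c < 1) : ∃ r : ℝ, 0 < r ∧ r < 1 ∧ c < r ^ n := by
  have h : Filter.Tendsto (fun r : ℝ => r ^ n) (nhdsWithin 1 (Set.Iio 1)) (nhds 1) := by
    simpa using ((continuous_pow n).tendsto (1 : ℝ)).mono_left nhdsWithin_le_nhds
  have h0 : ∀ᶠ r : ℝ in nhdsWithin 1 (Set.Iio 1), 0 < r :=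
    nhdsWithin_le_nhds (lt_mem_nhds one_pos)
  obtain ⟨r, h1, h2, h3⟩ :=
    (h0.and ((eventually_mem_nhdsWithin).and (h.eventually (lt_mem_nhds hc)))).exists
  exact ⟨r, h1, h2, h3⟩

lemma measure_cylinder {E F : Type*} [NormedAddCommGroup E] [NormedSpace ℝ E] [MeasureSpace E]
    [NormedAddCommGroup F] [NormedSpace ℝ F] [MeasureSpace F] [BorelSpace F]
    [FiniteDimensional ℝ F] [Nontrivial F] [(volume : Measure F).IsAddHaarMeasure] [SFinite (volume : Measure F)]
    {a : ℝ} (ha : 0 ≤ a) :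
    volume {p : E × F | ‖p.1‖ < 1 ∧ ‖p.2‖ < a} = ENNReal.ofReal (a ^ Module.finrank ℝ F) *
      (volume (Metric.ball (0 : E) 1) * volume (Metric.ball (0 : F) 1)) := by
  have : {p : E × F | ‖p.1‖ < 1 ∧ ‖p.2‖ < a} = Metric.ball 0 1 ×ˢ Metric.ball 0 a := by
    ext p; simp
  rw [this, Measure.volume_eq_prod, Measure.prod_prod, Measure.addHaar_ball _ _ ha]
  ring

/-- If a Hamiltonian on the product depends only on the first variable near `y`, its flow
on that slice is the flow in the first factor. -/
lemma hamiltonian_curve_eq_prodMk {m n : ℕ} {h : EuclideanSpace ℝ (Fin (m + m)) → ℝ}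
    {f : EuclideanSpace ℝ (Fin (m + m)) × EuclideanSpace ℝ (Fin (n + n)) → ℝ}
    (hh : Differentiable ℝ h) (hf : ContDiff ℝ 2 f) {M : ℝ}
    (hM : ∀ p, ‖fderiv ℝ (fderiv ℝ f) p‖ ≤ M)
    {X : EuclideanSpace ℝ (Fin (m + m)) → EuclideanSpace ℝ (Fin (m + m))}
    {Y : EuclideanSpace ℝ (Fin (m + m)) × EuclideanSpace ℝ (Fin (n + n)) →
      EuclideanSpace ℝ (Fin (m + m)) × EuclideanSpace ℝ (Fin (n + n))}
    (hX : ∀ x v, stdSymp m (X x) v = fderiv ℝ h x v)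
    (hY : ∀ p q, stdSymp m (Y p).1 q.1 + stdSymp n (Y p).2 q.2 = fderiv ℝ f p q)
    {y : EuclideanSpace ℝ (Fin (n + n))} (hy : ∀ x, f =ᶠ[nhds (x, y)] fun p => h p.1)
    {x : ℝ → EuclideanSpace ℝ (Fin (m + m))}
    {z : ℝ → EuclideanSpace ℝ (Fin (m + m)) × EuclideanSpace ℝ (Fin (n + n))}
    (hx : ∀ t, HasDerivAt x (X (x t)) t) (hz : ∀ t, HasDerivAt z (Y (z t)) t)
    (h0 : z 0 = (x 0, y)) (t : ℝ) : z t = (x t, y) := by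
  have hYX : ∀ x, Y (x, y) = (X x, 0) := fun x => by
    refine prodSympDual_injective m n (LinearMap.ext fun q => ?_)
    change stdSymp m (Y (x, y)).1 q.1 + stdSymp n (Y (x, y)).2 q.2
      = stdSymp m (X x) q.1 + stdSymp n 0 q.2
    have e : HasFDerivAt (fun p : EuclideanSpace ℝ (Fin (m + m)) ×
        EuclideanSpace ℝ (Fin (n + n)) => h p.1) _ (x, y) :=
      (hh x).hasFDerivAt.comp (x, y) hasFDerivAt_fst
    rw [hY, (hy x).fderiv_eq, e.fderiv, stdSymp_zero_left, hX]
    simp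
  have hM0 : 0 ≤ M := (ContinuousLinearMap.opNorm_nonneg _).trans (hM 0)
  have hlip : LipschitzWith ⟨M, hM0⟩ (fderiv ℝ f) :=
    lipschitzWith_of_nnnorm_fderiv_le
      ((hf.fderiv_right (m := 1) (by norm_num)).differentiable (by norm_num)) hM
  obtain ⟨L, hL⟩ := exists_lipschitzWith_of_prodSymp_eq hlip hY
  refine congrFun (ODE_solution_unique_univ (v := fun _ => Y) (s := fun _ => Set.univ) (K := L)
    (t₀ := 0) (fun t => hL.lipschitzOnWith) (fun t => ⟨hz t, trivial⟩)
    (g := fun t => (x t, y)) (fun t => ⟨?_, trivial⟩) h0) t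
  rw [hYX]
  exact (hx t).prodMk (hasDerivAt_const t y)

/-- We model `ℝ^{2N} = ℝ^{2ν} ⊕ (ℝ^{2ν})^ω` (with `N = ν + κ'`,
`1 ≤ ν`, `1 ≤ κ'`) as the product `E₁ × E₂` of the symplectic Euclidean spaces
`E₁ = ℝ^{2ν}` and `E₂ = ℝ^{2κ'}`; a symplectic linear map of `ℝ^{2N}` preserving
`ℝ^{2ν}` is then `A i (x,y) = (B i x, C i y)` with `B i`, `C i` symplectic linear.
Given Hamiltonians `H i` on `E₁` with `‖D²(H i)‖ < δ`, constant outside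
`B_{i-1}∘⋯∘B_0(U)` (`U` = open unit ball), there are `a > 0`, Hamiltonians `Ĥ i`
on `E₁ × E₂` with `‖D²(Ĥ i)‖ < 2δ`, constant outside `A_{i-1}∘⋯∘A_0(Û)` where
`Û = {(x,y) : ‖x‖ < 1, ‖y‖ < a}`, and a measurable `Ĝ ⊆ Û` with
`μ(Ĝ) > (1-κ)μ(Û)`, such that for the Hamiltonian flows (characterized by their
vector fields `ω(X x, v) = DH(x)·v` and the flow ODE) one has, on `Ĝ` and for all
`t`:  `A_{m-1}∘φ_{Ĥ_{m-1}}^t∘⋯∘A_0∘φ_{Ĥ_0}^t (x,y)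
   = (B_{m-1}∘φ_{H_{m-1}}^t∘⋯∘B_0∘φ_{H_0}^t x, C_{m-1}∘⋯∘C_0 y)`. -/
theorem stmt_6 (ν κ' : ℕ) (hν : 0 < ν) (hκ' : 0 < κ')
    (δ κ : ℝ) (hδ : 0 < δ) (hκ : 0 < κ) (m : ℕ)
    (B : ℕ → EuclideanSpace ℝ (Fin (ν + ν)) ≃ₗ[ℝ] EuclideanSpace ℝ (Fin (ν + ν)))
    (C : ℕ → EuclideanSpace ℝ (Fin (κ' + κ')) ≃ₗ[ℝ] EuclideanSpace ℝ (Fin (κ' + κ')))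
    (hB : ∀ i < m, ∀ v w, stdSymp ν (B i v) (B i w) = stdSymp ν v w)
    (hC : ∀ i < m, ∀ v w, stdSymp κ' (C i v) (C i w) = stdSymp κ' v w)
    (H : ℕ → EuclideanSpace ℝ (Fin (ν + ν)) → ℝ)
    (hHsmooth : ∀ i < m, ContDiff ℝ (⊤ : ℕ∞) (H i))
    (hHd2 : ∀ i < m, ∀ x, ‖fderiv ℝ (fderiv ℝ (H i)) x‖ < δ)
    (hHconst : ∀ i < m, ∃ c : ℝ,
      ∀ x ∉ chain (fun j => (B j : EuclideanSpace ℝ (Fin (ν + ν)) →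
        EuclideanSpace ℝ (Fin (ν + ν)))) i '' Metric.ball 0 1, H i x = c) :
    ∃ a : ℝ, 0 < a ∧
    ∃ Hhat : ℕ → (EuclideanSpace ℝ (Fin (ν + ν)) × EuclideanSpace ℝ (Fin (κ' + κ'))) → ℝ,
    ∃ Ghat : Set (EuclideanSpace ℝ (Fin (ν + ν)) × EuclideanSpace ℝ (Fin (κ' + κ'))),
      (∀ i < m, ContDiff ℝ (⊤ : ℕ∞) (Hhat i)) ∧
      (∀ i < m, ∀ p, ‖fderiv ℝ (fderiv ℝ (Hhat i)) p‖ < 2 * δ) ∧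
      (∀ i < m, ∃ c : ℝ, ∀ p ∉ chain (fun j q => ((B j q.1, C j q.2) :
          EuclideanSpace ℝ (Fin (ν + ν)) × EuclideanSpace ℝ (Fin (κ' + κ')))) i ''
          {p | ‖p.1‖ < 1 ∧ ‖p.2‖ < a}, Hhat i p = c) ∧
      MeasurableSet Ghat ∧ Ghat ⊆ {p | ‖p.1‖ < 1 ∧ ‖p.2‖ < a} ∧
      ENNReal.ofReal (1 - κ) * volume {p : EuclideanSpace ℝ (Fin (ν + ν)) ×
        EuclideanSpace ℝ (Fin (κ' + κ')) | ‖p.1‖ < 1 ∧ ‖p.2‖ < a} < volume Ghat ∧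
      -- for the Hamiltonian vector fields `X i` of `H i` and `Xhat i` of `Hhat i`,
      -- and the corresponding flows `φ i` and `φhat i`:
      ∀ (X : ℕ → EuclideanSpace ℝ (Fin (ν + ν)) → EuclideanSpace ℝ (Fin (ν + ν)))
        (Xhat : ℕ → (EuclideanSpace ℝ (Fin (ν + ν)) × EuclideanSpace ℝ (Fin (κ' + κ'))) →
          (EuclideanSpace ℝ (Fin (ν + ν)) × EuclideanSpace ℝ (Fin (κ' + κ')))),
        (∀ i < m, ∀ x v, stdSymp ν (X i x) v = fderiv ℝ (H i) x v) →
        (∀ i < m, ∀ p q, stdSymp ν (Xhat i p).1 q.1 + stdSymp κ' (Xhat i p).2 q.2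
          = fderiv ℝ (Hhat i) p q) →
        ∀ (φ : ℕ → ℝ → EuclideanSpace ℝ (Fin (ν + ν)) → EuclideanSpace ℝ (Fin (ν + ν)))
          (φhat : ℕ → ℝ → (EuclideanSpace ℝ (Fin (ν + ν)) × EuclideanSpace ℝ (Fin (κ' + κ'))) →
            (EuclideanSpace ℝ (Fin (ν + ν)) × EuclideanSpace ℝ (Fin (κ' + κ')))),
          (∀ i < m, (∀ x, φ i 0 x = x) ∧
            ∀ x t, HasDerivAt (fun s => φ i s x) (X i (φ i t x)) t) →
          (∀ i < m, (∀ p, φhat i 0 p = p) ∧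
            ∀ p t, HasDerivAt (fun s => φhat i s p) (Xhat i (φhat i t p)) t) →
          ∀ p ∈ Ghat, ∀ t : ℝ,
            chain (fun i q => (B i (φhat i t q).1, C i (φhat i t q).2)) m p
              = (chain (fun i x => B i (φ i t x)) m p.1,
                 chain (fun i y => C i y) m p.2) := by
  choose! c hc using hHconst
  have : Nonempty (Fin (κ' + κ')) := ⟨⟨0, by omega⟩⟩
  obtain ⟨r, hr0, hr1, hrκ⟩ := exists_pow_gt_of_lt_one
    (Module.finrank ℝ (EuclideanSpace ℝ (Fin (κ' + κ')))) (sub_lt_self 1 hκ)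
  let ψ : ContDiffBump (0 : EuclideanSpace ℝ (Fin (κ' + κ'))) := ⟨r, 1, hr0, hr1⟩
  let h : ℕ → EuclideanSpace ℝ (Fin (ν + ν)) → ℝ := fun i x => H i x - c i
  let g : ℕ → EuclideanSpace ℝ (Fin (κ' + κ')) → ℝ := fun i y => ψ ((chainEquiv C i).symm y)
  have hh : ∀ i < m, ContDiff ℝ (⊤ : ℕ∞) (h i) := fun i hi => (hHsmooth i hi).sub contDiff_const
  have hdh : ∀ i, fderiv ℝ (h i) = fderiv ℝ (H i) := fun i => by
    funext x
    exact fderiv_sub_const (c i)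
  have hg : ∀ i, ContDiff ℝ (⊤ : ℕ∞) (g i) := fun i =>
    ψ.contDiff.comp (chainEquiv C i).symm.toContinuousLinearEquiv.contDiff
  have hh0 : ∀ i < m, ∀ x, h i x ≠ 0 → ‖(chainEquiv B i).symm x‖ < 1 := by
    intro i hi x hx
    by_contra hlt
    refine hx (sub_eq_zero.2 (hc i hi x ?_))
    rw [chain_coe_eq_chainEquiv]
    rintro ⟨u, hu, rfl⟩
    exact hlt (by simpa using hu)
  have hg0 : ∀ i y, g i y ≠ 0 → ‖(chainEquiv C i).symm y‖ < 1 := by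
    intro i y hy
    have : (chainEquiv C i).symm y ∈ Function.support ψ := hy
    rw [ψ.support_eq] at this
    simpa [ψ] using this
  have hhs : ∀ i < m, HasCompactSupport (h i) := fun i hi => by
    refine HasCompactSupport.intro ((isCompact_closedBall
      (0 : EuclideanSpace ℝ (Fin (ν + ν))) 1).image
        (chainEquiv B i).toContinuousLinearEquiv.continuous) fun x hx => ?_
    by_contra hne
    exact hx ⟨_, mem_closedBall_zero_iff.2 (hh0 i hi x hne).le, (chainEquiv B i).apply_symm_apply x⟩
  have hgs : ∀ i, HasCompactSupport (g i) := fun i => by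
    refine HasCompactSupport.intro ((isCompact_closedBall
      (0 : EuclideanSpace ℝ (Fin (κ' + κ'))) 1).image
        (chainEquiv C i).toContinuousLinearEquiv.continuous) fun y hy => ?_
    by_contra hne
    exact hy ⟨_, mem_closedBall_zero_iff.2 (hg0 i y hne).le, (chainEquiv C i).apply_symm_apply y⟩
  have hev : ∀ᶠ a : ℝ in Filter.atTop, ∀ i ∈ Finset.range m, ∀ p,
      ‖fderiv ℝ (fderiv ℝ fun p : EuclideanSpace ℝ (Fin (ν + ν)) ×
        EuclideanSpace ℝ (Fin (κ' + κ')) => h i p.1 * g i (a⁻¹ • p.2)) p‖ < δ + δ := by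
    refine (Filter.eventually_all_finset _).2 fun i hi => ?_
    rw [Finset.mem_range] at hi
    refine eventually_norm_fderiv_fderiv_mul_scaled_lt ((hh i hi).of_le (WithTop.coe_le_coe.2 le_top))
      ((hg i).of_le (WithTop.coe_le_coe.2 le_top)) (hhs i hi) (hgs i) (fun y => (abs_of_nonneg ψ.nonneg).trans_le ψ.le_one)
      hδ fun x => ?_
    rw [hdh]
    exact hHd2 i hi x
  obtain ⟨a, ha, ha0⟩ := (hev.and (Filter.eventually_gt_atTop 0)).exists
  have hHhat : ∀ i < m, ContDiff ℝ (⊤ : ℕ∞) fun p : EuclideanSpace ℝ (Fin (ν + ν)) ×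
      EuclideanSpace ℝ (Fin (κ' + κ')) => h i p.1 * g i (a⁻¹ • p.2) := fun i hi =>
    ((hh i hi).comp contDiff_fst).mul ((hg i).comp (contDiff_snd.const_smul a⁻¹))
  have hnorm : ∀ y : EuclideanSpace ℝ (Fin (κ' + κ')), ‖a⁻¹ • y‖ = ‖y‖ / a := fun y => by
    rw [norm_smul, Real.norm_of_nonneg (inv_pos.2 ha0).le, inv_mul_eq_div]
  refine ⟨a, ha0, fun i p => h i p.1 * g i (a⁻¹ • p.2), {p | ‖p.1‖ < 1 ∧ ‖p.2‖ < r * a},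
    hHhat, fun i hi p => ?_, fun i hi => ⟨0, fun p hp => ?_⟩, ?_, fun p hp => ?_, ?_, ?_⟩
  · rw [two_mul]
    exact ha i (Finset.mem_range.2 hi) p
  · by_contra hne
    refine hp ⟨((chainEquiv B i).symm p.1, (chainEquiv C i).symm p.2),
      ⟨hh0 i hi _ (left_ne_zero_of_mul hne), ?_⟩, ?_⟩
    · have := hg0 i _ (right_ne_zero_of_mul hne)
      rwa [map_smul, hnorm, div_lt_one ha0] at this
    · rw [chain_prod, chain_coe_eq_chainEquiv, chain_coe_eq_chainEquiv]
      simp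
  · exact ((isOpen_lt continuous_fst.norm continuous_const).inter
      (isOpen_lt continuous_snd.norm continuous_const)).measurableSet
  · exact ⟨hp.1, hp.2.trans (mul_lt_of_lt_one_left ha0 hr1)⟩
  · rw [measure_cylinder ha0.le, measure_cylinder (mul_pos hr0 ha0).le, mul_pow,
      ENNReal.ofReal_mul (pow_pos hr0 _).le, mul_assoc]
    refine (ENNReal.mul_lt_mul_iff_left ?_ ?_).2
      ((ENNReal.ofReal_lt_ofReal_iff (pow_pos hr0 _)).2 hrκ)
    · exact mul_ne_zero (ENNReal.ofReal_pos.2 (pow_pos ha0 _)).ne'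
        (mul_ne_zero (Metric.measure_ball_pos _ _ one_pos).ne'
          (Metric.measure_ball_pos _ _ one_pos).ne')
    · exact ENNReal.mul_ne_top ENNReal.ofReal_ne_top
        (ENNReal.mul_ne_top measure_ball_lt_top.ne measure_ball_lt_top.ne)
  · intro X Xhat hX hXhat φ φhat hφ hφhat p hp t
    suffices hk : ∀ k ≤ m, chain (fun i q => (B i (φhat i t q).1, C i (φhat i t q).2)) k p
        = (chain (fun i x => B i (φ i t x)) k p.1, chain (fun i y => C i y) k p.2) from hk m le_rfl
    intro k
    induction k with
    | zero => exact fun _ => rfl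
    | succ k ih =>
      intro hk
      simp only [chain, Function.comp_apply]
      rw [ih (by omega)]
      have hflow := hamiltonian_curve_eq_prodMk ((hh k hk).differentiable (by simp))
        ((hHhat k hk).of_le (WithTop.coe_le_coe.2 le_top))
        (fun p => (ha k (Finset.mem_range.2 hk) p).le)
        (fun x v => (hX k hk x v).trans (by rw [hdh])) (hXhat k hk)
        (y := chain (fun i y => C i y) k p.2) ?_
        ((hφ k hk).2 (chain (fun i x => B i (φ i t x)) k p.1))
        ((hφhat k hk).2 (chain (fun i x => B i (φ i t x)) k p.1, chain (fun i y => C i y) k p.2))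
        (by rw [(hφhat k hk).1, (hφ k hk).1]) t
      · rw [hflow]
      · intro x
        have hopen : IsOpen {q : EuclideanSpace ℝ (Fin (ν + ν)) × EuclideanSpace ℝ (Fin (κ' + κ')) |
            ‖(chainEquiv C k).symm (a⁻¹ • q.2)‖ < r} :=
          isOpen_lt ((chainEquiv C k).symm.toContinuousLinearEquiv.continuous.comp
            (continuous_snd.const_smul a⁻¹)).norm continuous_const
        refine Filter.eventuallyEq_of_mem (hopen.mem_nhds ?_) fun q hq => ?_
        · rw [chain_coe_eq_chainEquiv, Set.mem_ofPred_eq, map_smul, hnorm,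
            LinearEquiv.symm_apply_apply, div_lt_iff₀ ha0]
          exact hp.2
        · have : g k (a⁻¹ • q.2) = 1 :=
            ψ.one_of_mem_closedBall (mem_closedBall_zero_iff.2 (le_of_lt hq))
          simp only [this, mul_one]
end
end

section
/- Let f be an aperiodic invertible measure-preserving transformation of a standard Borel probability space (X, μ), let Γ ⊂ X be a measurable f-invariant set, and let N : Γ → ℕ be a measurable function. Then there is a measurable set B ⊂ Γ such that: (i) for almost every point x ∈ Γ there exists n ∈ ℤ with f^n(x) ∈ B (the orbit of almost every point in Γ visits B); and (ii) for every x ∈ B and every integer j with 1 ≤ j ≤ N(x), the point f^j(x) does not belong to B. -/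
open MeasureTheory

/-- The saturation of a set under a permutation: the points whose two-sided orbit visits it. -/
def orbitSaturation {X : Type*} (e : Equiv.Perm X) (V : Set X) : Set X :=
  {x | ∃ n : ℤ, (e ^ n) x ∈ V}

theorem zpow_apply_mem_orbitSaturation_iff {X : Type*} (e : Equiv.Perm X) (V : Set X) (m : ℤ)
    (x : X) : (e ^ m) x ∈ orbitSaturation e V ↔ x ∈ orbitSaturation e V := by
  constructor
  · rintro ⟨n, hn⟩
    exact ⟨n + m, by rwa [zpow_add, Equiv.Perm.mul_apply]⟩
  · rintro ⟨n, hn⟩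
    exact ⟨n - m, by rwa [← Equiv.Perm.mul_apply, ← zpow_add, sub_add_cancel]⟩

theorem orbitSaturation_eq_iterate {X : Type*} (e : Equiv.Perm X) (V : Set X) :
    orbitSaturation e V = {x | ∃ n : ℕ, e^[n] x ∈ V ∨ e.symm^[n] x ∈ V} := by
  ext x
  constructor
  · rintro ⟨n, hn⟩
    obtain ⟨m, rfl | rfl⟩ := n.eq_nat_or_neg
    · exact ⟨m, Or.inl (by rwa [zpow_natCast, ← Equiv.Perm.iterate_eq_pow] at hn)⟩
    · refine ⟨m, Or.inr ?_⟩
      rwa [zpow_neg, ← inv_zpow, zpow_natCast, ← Equiv.Perm.iterate_eq_pow] at hn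
  · rintro ⟨m, hm | hm⟩
    · exact ⟨m, by rwa [zpow_natCast, ← Equiv.Perm.iterate_eq_pow]⟩
    · refine ⟨-m, ?_⟩
      rwa [zpow_neg, ← inv_zpow, zpow_natCast, ← Equiv.Perm.iterate_eq_pow]

theorem measurableSet_orbitSaturation {X : Type*} [MeasurableSpace X] (e : X ≃ᵐ X) {V : Set X}
    (hV : MeasurableSet V) : MeasurableSet (orbitSaturation e.toEquiv V) := by
  rw [orbitSaturation_eq_iterate]
  have h : {x | ∃ n : ℕ, e.toEquiv^[n] x ∈ V ∨ e.toEquiv.symm^[n] x ∈ V} =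
      ⋃ n : ℕ, e^[n] ⁻¹' V ∪ e.symm^[n] ⁻¹' V := by
    ext x
    simp only [Set.mem_iUnion]
    rfl
  rw [h]
  exact MeasurableSet.iUnion fun n =>
    (e.measurable.iterate n hV).union (e.symm.measurable.iterate n hV)

/-- From a countable family of sets one can select, on each orbit that visits some member of the
family, the points of the first member visited. -/
theorem exists_measurableSet_first_visited {X ι : Type*} [MeasurableSpace X] [Encodable ι]
    (e : X ≃ᵐ X) (V : ι → Set X) (hV : ∀ i, MeasurableSet (V i)) :
    ∃ B : Set X, MeasurableSet B ∧ B ⊆ ⋃ i, V i ∧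
      (⋃ i, V i) ⊆ orbitSaturation e.toEquiv B ∧
      ∀ x ∈ B, ∃ i, x ∈ V i ∧ ∀ n : ℤ, (e.toEquiv ^ n : Equiv.Perm X) x ∈ B →
        (e.toEquiv ^ n : Equiv.Perm X) x ∈ V i := by
  let S : ι → Set X := fun i => orbitSaturation e.toEquiv (V i)
  let B : Set X := ⋃ i, V i ∩ ⋂ l, ⋂ _ : Encodable.encode l < Encodable.encode i, (S l)ᶜ
  have hmemB : ∀ x, x ∈ B ↔
      ∃ i, x ∈ V i ∧ ∀ l, Encodable.encode l < Encodable.encode i → x ∉ S l := by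
    intro x
    simp [B]
  have hVS : ∀ i x, x ∈ V i → x ∈ S i := fun i x hx => ⟨0, by simpa using hx⟩
  refine ⟨B, ?_, ?_, ?_, ?_⟩
  · exact MeasurableSet.iUnion fun i => (hV i).inter <| MeasurableSet.iInter fun l =>
      MeasurableSet.iInter fun _ => (measurableSet_orbitSaturation e (hV l)).compl
  · exact Set.iUnion_mono fun i => Set.inter_subset_left
  · intro x hx
    obtain ⟨i₀, hi₀⟩ := Set.mem_iUnion.1 hx
    obtain ⟨i, ⟨n, hn⟩, hmin⟩ := (measure (Encodable.encode : ι → ℕ)).wf.has_min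
      {i | x ∈ S i} ⟨i₀, hVS i₀ x hi₀⟩
    refine ⟨n, (hmemB _).2 ⟨i, hn, fun l hl hmem => ?_⟩⟩
    exact hmin l ((zpow_apply_mem_orbitSaturation_iff _ _ _ _).1 hmem) hl
  · intro x hx
    obtain ⟨i, hxi, hi⟩ := (hmemB x).1 hx
    refine ⟨i, hxi, fun n hn => ?_⟩
    obtain ⟨l, hxl, hl⟩ := (hmemB _).1 hn
    have h₁ : ¬ Encodable.encode l < Encodable.encode i := fun h =>
      hi l h ((zpow_apply_mem_orbitSaturation_iff _ _ _ _).1 (hVS l _ hxl))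
    have h₂ : ¬ Encodable.encode i < Encodable.encode l := fun h =>
      hl i h ((zpow_apply_mem_orbitSaturation_iff _ _ _ _).2 (hVS i _ hxi))
    obtain rfl : l = i := Encodable.encode_injective (by omega)
    exact hxl

/-- Countably many measurable sets that do not return to themselves within time `k` cover all
aperiodic points. -/
theorem exists_countable_cover_no_return {X : Type*} [MeasurableSpace X] [StandardBorelSpace X]
    {f : X → X} (hf : Measurable f) (k : ℕ) :
    ∃ U : ℕ → Set X, (∀ i, MeasurableSet (U i)) ∧
      (∀ i, ∀ x ∈ U i, ∀ j, 1 ≤ j → j ≤ k → f^[j] x ∉ U i) ∧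
      ∀ x, (∀ n, 0 < n → f^[n] x ≠ x) → ∃ i, x ∈ U i := by
  let := upgradeStandardBorel X
  obtain ⟨b, hb⟩ := ((TopologicalSpace.countable_countableBasis X).insert ∅).exists_eq_range
    (Set.insert_nonempty _ _)
  have hbasis := TopologicalSpace.isBasis_countableBasis X
  have hbm : ∀ i, MeasurableSet (b i) := fun i => by
    have hi := Set.mem_range_self (f := b) i
    rw [← hb] at hi
    obtain hi | hi := hi
    · exact hi ▸ MeasurableSet.empty
    · exact (hbasis.isOpen hi).measurableSet
  refine ⟨fun i => b i ∩ ⋂ j ∈ Finset.Icc 1 k, (f^[j] ⁻¹' b i)ᶜ, fun i => ?_, ?_, ?_⟩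
  · exact (hbm i).inter <| Finset.measurableSet_biInter _ fun j _ =>
      (hf.iterate j (hbm i)).compl
  · intro i x hx j h1 hk hj
    exact Set.mem_iInter₂.1 hx.2 j (Finset.mem_Icc.2 ⟨h1, hk⟩) hj.1
  · intro x hx
    have hfin : ((fun j => f^[j] x) '' (Finset.Icc 1 k : Set ℕ)).Finite :=
      (Finset.finite_toSet _).image _
    obtain ⟨v, hv, hxv, hsub⟩ := hbasis.exists_subset_of_mem_open
      (a := x) (u := ((fun j => f^[j] x) '' (Finset.Icc 1 k : Set ℕ))ᶜ)
      (by
        rintro ⟨j, hj, hjx⟩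
        exact hx j (Finset.mem_Icc.1 hj).1 hjx)
      hfin.isClosed.isOpen_compl
    obtain ⟨i, rfl⟩ := hb.subset (Set.mem_insert_of_mem _ hv)
    exact ⟨i, hxv, Set.mem_iInter₂.2 fun j hj hjb => hsub hjb ⟨j, hj, rfl⟩⟩

/-- Let `f` be an aperiodic invertible measure-preserving
transformation (with inverse `g`) of a standard Borel probability space `(X, μ)`,
let `Γ` be a measurable `f`-invariant set and `N : X → ℕ` measurable.  Then there
is a measurable set `B ⊆ Γ` such that (i) the (full, two-sided) orbit of almost
every point of `Γ` visits `B`, and (ii) for every `x ∈ B` and every `1 ≤ j ≤ N x`,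
`f^[j] x ∉ B`. -/
theorem stmt_17 {X : Type*} [MeasurableSpace X] [StandardBorelSpace X]
    (μ : Measure X) [IsProbabilityMeasure μ]
    (f g : X → X) (hf : Measurable f) (hg : Measurable g)
    (hgf : Function.LeftInverse g f) (hfg : Function.RightInverse g f)
    (hpres : MeasurePreserving f μ μ)
    (haper : μ {x | ∃ n : ℕ, 0 < n ∧ f^[n] x = x} = 0)
    (Γ : Set X) (hΓmeas : MeasurableSet Γ) (hΓinv : f '' Γ = Γ)
    (N : X → ℕ) (hN : Measurable N) :
    ∃ B : Set X, MeasurableSet B ∧ B ⊆ Γ ∧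
      μ (Γ \ {x | ∃ n : ℕ, f^[n] x ∈ B ∨ g^[n] x ∈ B}) = 0 ∧
      ∀ x ∈ B, ∀ j : ℕ, 1 ≤ j → j ≤ N x → f^[j] x ∉ B := by
  choose U hUm hUret hUcov using fun k => exists_countable_cover_no_return hf k
  let e : X ≃ᵐ X := ⟨⟨f, g, hgf, hfg⟩, hf, hg⟩
  obtain ⟨B, hBm, hBsub, hBsat, hBret⟩ := exists_measurableSet_first_visited e
    (fun p : ℕ × ℕ => Γ ∩ N ⁻¹' {p.1} ∩ U p.1 p.2)
    (fun p => (hΓmeas.inter (hN (measurableSet_singleton _))).inter (hUm _ _))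
  refine ⟨B, hBm, fun x hx => ?_, measure_mono_null (fun x hx => ?_) haper, ?_⟩
  · obtain ⟨p, hp⟩ := Set.mem_iUnion.1 (hBsub hx)
    exact hp.1.1
  · by_contra hper
    obtain ⟨i, hi⟩ := hUcov (N x) x fun n hn h => hper ⟨n, hn, h⟩
    have hsat := hBsat (Set.mem_iUnion.2 ⟨(N x, i), ⟨hx.1, rfl⟩, hi⟩)
    rw [orbitSaturation_eq_iterate] at hsat
    exact hx.2 hsat
  · intro x hx j h1 hj hjB
    obtain ⟨⟨k, i⟩, ⟨⟨-, hk⟩, hxU⟩, hret⟩ := hBret x hx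
    have hpow : (e.toEquiv ^ (j : ℤ) : Equiv.Perm X) x = f^[j] x := by
      rw [zpow_natCast, ← Equiv.Perm.iterate_eq_pow]
      rfl
    have hmem := (hret j (by rwa [hpow])).2
    rw [hpow] at hmem
    exact hUret k i x hxU j h1 (hj.trans_eq hk) hmem
end
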